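/- Let k be a field of characteristic 2 and let S be a smooth del Pezzo surface of degree 1 over k. Let φ : S → Q ⊂ P^3 be the degree 2 morphism given by the linear system |−2K_S|, whose image is a quadric cone Q in P^3. Then there is a dense open subset U of the dual projective space (P^3)^∨ such that for every hyperplane H ∈ U, the fiber S_H = φ^{−1}(H ∩ Q) is smooth. -/

import Mathlib

open MvPolynomial

universe u

/-- The weights of the weighted projective space `ℙ(1,1,2,3)`. -/
def dpWeight : Fin 4 → ℕ := ![1, 1, 2, 3]

/-- A smooth del Pezzo surface `S` of degree `1` over `k`, presented (as always) as the
vanishing locus of a sextic `F` in the weighted projective space `ℙ(1,1,2,3)`: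
`F` is weighted homogeneous of degree `6` and its affine cone is smooth away from the
origin (Jacobian criterion over an algebraic closure). -/
def SmoothSexticDelPezzo {k : Type u} [Field k] (F : MvPolynomial (Fin 4) k) : Prop :=
  MvPolynomial.IsWeightedHomogeneous dpWeight F 6 ∧
    ∀ p : Fin 4 → AlgebraicClosure k, p ≠ 0 →
      MvPolynomial.eval p (MvPolynomial.map (algebraMap k (AlgebraicClosure k)) F) = 0 →
      ∃ i : Fin 4,
        MvPolynomial.eval p
          (MvPolynomial.map (algebraMap k (AlgebraicClosure k))
            (MvPolynomial.pderiv i F)) ≠ 0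

/-- The morphism `φ : S → Q ⊂ ℙ³` given by `|-2K_S|` is the projection
`ℙ(1,1,2,3) → ℙ(1,1,2)`, `[x:y:z:w] ↦ [x²:xy:y²:z]`, onto the quadric cone
`Q = {X₀X₂ = X₁²}`.  The pullback to `S` of the hyperplane
`H_a = {a₀X₀ + a₁X₁ + a₂X₂ + a₃X₃ = 0}` is therefore cut out by
`a₀x² + a₁xy + a₂y² + a₃z`. -/
noncomputable def hyperplanePullback {K : Type u} [Field K] (a : Fin 4 → K) :
    MvPolynomial (Fin 4) K :=
  C (a 0) * X 0 ^ 2 + C (a 1) * (X 0 * X 1) + C (a 2) * X 1 ^ 2 + C (a 3) * X 2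

/-- The fiber `S_H = φ⁻¹(H_a ∩ Q)`, a curve in `ℙ(1,1,2,3)` cut out by `F` and the
pullback of `H_a`, is smooth: at each geometric point of the affine cone the Jacobian
matrix of the two equations has rank `2`. -/
def SmoothHyperplaneSection {k : Type u} [Field k] (F : MvPolynomial (Fin 4) k)
    (a : Fin 4 → AlgebraicClosure k) : Prop :=
  ∀ p : Fin 4 → AlgebraicClosure k, p ≠ 0 →
    MvPolynomial.eval p (MvPolynomial.map (algebraMap k (AlgebraicClosure k)) F) = 0 →
    MvPolynomial.eval p (hyperplanePullback a) = 0 →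
    ∃ i j : Fin 4,
      MvPolynomial.eval p
        (MvPolynomial.pderiv i
            (MvPolynomial.map (algebraMap k (AlgebraicClosure k)) F) *
          MvPolynomial.pderiv j (hyperplanePullback a) -
        MvPolynomial.pderiv j
            (MvPolynomial.map (algebraMap k (AlgebraicClosure k)) F) *
          MvPolynomial.pderiv i (hyperplanePullback a)) ≠ 0

/-- The general weighted homogeneous polynomial of degree `6` for the weights `(1, 1, 2, 3)`,
with coefficients grouped by the powers of the last two variables. -/
noncomputable def weightedSextic {k : Type*} [CommRing k] (c b : k) (l : Fin 2 → k)
    (f : Fin 4 → k) (u : Fin 3 → k) (v : Fin 5 → k) (s : Fin 7 → k) : MvPolynomial (Fin 4) k :=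
  C c * X 3 ^ 2 +
  ((C (l 0) * X 0 + C (l 1) * X 1) * X 2 +
    (C (f 0) * X 1 ^ 3 + C (f 1) * (X 0 * X 1 ^ 2) + C (f 2) * (X 0 ^ 2 * X 1) +
      C (f 3) * X 0 ^ 3)) * X 3 +
  (C b * X 2 ^ 3 +
  (C (u 0) * X 1 ^ 2 + C (u 1) * (X 0 * X 1) + C (u 2) * X 0 ^ 2) * X 2 ^ 2 +
  (C (v 0) * X 1 ^ 4 + C (v 1) * (X 0 * X 1 ^ 3) + C (v 2) * (X 0 ^ 2 * X 1 ^ 2) +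
    C (v 3) * (X 0 ^ 3 * X 1) + C (v 4) * X 0 ^ 4) * X 2 +
  (C (s 0) * X 1 ^ 6 + C (s 1) * (X 0 * X 1 ^ 5) + C (s 2) * (X 0 ^ 2 * X 1 ^ 4) +
    C (s 3) * (X 0 ^ 3 * X 1 ^ 3) + C (s 4) * (X 0 ^ 4 * X 1 ^ 2) + C (s 5) * (X 0 ^ 5 * X 1) +
    C (s 6) * X 0 ^ 6))

theorem exists_eq_weightedSextic {k : Type*} [CommRing k] {F : MvPolynomial (Fin 4) k}
    (hF : IsWeightedHomogeneous dpWeight F 6) :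
    ∃ c b l f u v s, F = weightedSextic c b l f u v s := by
  have hw : ∀ d ∈ F.support, d 0 + d 1 + 2 * d 2 + 3 * d 3 = 6 := by
    intro d hd
    have := hF (mem_support_iff.1 hd)
    rw [Finsupp.weight_apply, Finsupp.sum_fintype _ _ (by simp)] at this
    simp [Fin.sum_univ_four, dpWeight] at this
    omega
  let g : ℕ → ℕ → ℕ → k := fun n m i ↦
    coeff (Finsupp.equivFunOnFinite.symm ![i, 6 - 3 * n - 2 * m - i, m, n]) F
  have key : F = ∑ t ∈ (Finset.range 3).sigma fun n ↦ (Finset.range ((6 - 3 * n) / 2 + 1)).sigma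
      fun m ↦ Finset.range (7 - 3 * n - 2 * m),
      C (g t.1 t.2.1 t.2.2) *
        (X 0 ^ t.2.2 * X 1 ^ (6 - 3 * t.1 - 2 * t.2.1 - t.2.2) * X 2 ^ t.2.1 * X 3 ^ t.1) := by
    have hd1 : ∀ d ∈ F.support,
        Finsupp.equivFunOnFinite.symm ![d 0, 6 - 3 * d 3 - 2 * d 2 - d 0, d 2, d 3] = d := by
      intro d hd
      have := hw d hd
      ext i
      fin_cases i <;> simp
      omega
    conv_lhs => rw [F.as_sum]
    refine Finset.sum_of_injOn (fun d ↦ ⟨d 3, d 2, d 0⟩) ?_ ?_ ?_ ?_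
    · intro d hd d' hd' h
      simp only [Sigma.mk.injEq, heq_eq_eq] at h
      rw [← hd1 d hd, ← hd1 d' hd', h.1, h.2.1, h.2.2]
    · intro d hd
      have := hw d hd
      simp
      omega
    · rintro ⟨n, m, i⟩ ht hn
      have : g n m i = 0 := by
        by_contra h0
        refine hn ⟨_, mem_support_iff.2 h0, ?_⟩
        simp
      simp [this]
    · intro d hd
      have h1 : g (d 3) (d 2) (d 0) = coeff d F := by simp only [g, hd1 d hd]
      have := hw d hd
      have h2 : 6 - 3 * d 3 - 2 * d 2 - d 0 = d 1 := by omega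
      simp only [h1, h2]
      rw [monomial_eq, Finsupp.prod_fintype _ _ (by simp), Fin.prod_univ_four]
  refine ⟨g 2 0 0, g 0 3 0, ![g 1 1 1, g 1 1 0], ![g 1 0 0, g 1 0 1, g 1 0 2, g 1 0 3],
    ![g 0 2 0, g 0 2 1, g 0 2 2], ![g 0 1 0, g 0 1 1, g 0 1 2, g 0 1 3, g 0 1 4],
    ![g 0 0 0, g 0 0 1, g 0 0 2, g 0 0 3, g 0 0 4, g 0 0 5, g 0 0 6], ?_⟩
  rw [key]
  clear_value g
  simp only [Finset.sum_sigma, Finset.sum_range_succ, Finset.sum_range_zero]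
  simp [weightedSextic]
  ring

section
variable {k Ω : Type*} [Field k] [Field Ω] [Algebra k Ω] (c b : k) (l : Fin 2 → k)
    (f : Fin 4 → k) (u : Fin 3 → k) (v : Fin 5 → k) (s : Fin 7 → k)

theorem aeval_weightedSextic (p : Fin 4 → Ω) :
    aeval p (weightedSextic c b l f u v s) =
      algebraMap k Ω c * p 3 ^ 2 +
      ((algebraMap k Ω (l 0) * p 0 + algebraMap k Ω (l 1) * p 1) * p 2 +
        (algebraMap k Ω (f 0) * p 1 ^ 3 + algebraMap k Ω (f 1) * (p 0 * p 1 ^ 2) +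
          algebraMap k Ω (f 2) * (p 0 ^ 2 * p 1) + algebraMap k Ω (f 3) * p 0 ^ 3)) * p 3 +
      (algebraMap k Ω b * p 2 ^ 3 +
      (algebraMap k Ω (u 0) * p 1 ^ 2 + algebraMap k Ω (u 1) * (p 0 * p 1) +
        algebraMap k Ω (u 2) * p 0 ^ 2) * p 2 ^ 2 +
      (algebraMap k Ω (v 0) * p 1 ^ 4 + algebraMap k Ω (v 1) * (p 0 * p 1 ^ 3) +
        algebraMap k Ω (v 2) * (p 0 ^ 2 * p 1 ^ 2) + algebraMap k Ω (v 3) * (p 0 ^ 3 * p 1) +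
        algebraMap k Ω (v 4) * p 0 ^ 4) * p 2 +
      (algebraMap k Ω (s 0) * p 1 ^ 6 + algebraMap k Ω (s 1) * (p 0 * p 1 ^ 5) +
        algebraMap k Ω (s 2) * (p 0 ^ 2 * p 1 ^ 4) + algebraMap k Ω (s 3) * (p 0 ^ 3 * p 1 ^ 3) +
        algebraMap k Ω (s 4) * (p 0 ^ 4 * p 1 ^ 2) + algebraMap k Ω (s 5) * (p 0 ^ 5 * p 1) +
        algebraMap k Ω (s 6) * p 0 ^ 6)) := by
  simp only [weightedSextic, map_add, map_mul, map_pow, aeval_X, aeval_C]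

variable [CharP Ω 2]

theorem aeval_pderiv_zero_weightedSextic (p : Fin 4 → Ω) :
    aeval p (pderiv 0 (weightedSextic c b l f u v s)) =
      (algebraMap k Ω (l 0) * p 2 + algebraMap k Ω (f 1) * p 1 ^ 2 +
        algebraMap k Ω (f 3) * p 0 ^ 2) * p 3 +
      p 1 * (algebraMap k Ω (u 1) * p 2 ^ 2 +
        (algebraMap k Ω (v 1) * p 1 ^ 2 + algebraMap k Ω (v 3) * p 0 ^ 2) * p 2 +
        (algebraMap k Ω (s 1) * p 1 ^ 4 + algebraMap k Ω (s 3) * (p 0 ^ 2 * p 1 ^ 2) +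
          algebraMap k Ω (s 5) * p 0 ^ 4)) := by
  have h2 : (2 : Ω) = 0 := CharTwo.two_eq_zero
  have h3 : (3 : Ω) = 1 := by linear_combination h2
  have h4 : (4 : Ω) = 0 := by linear_combination 2 * h2
  have h5 : (5 : Ω) = 1 := by linear_combination 2 * h2
  have h6 : (6 : Ω) = 0 := by linear_combination 3 * h2
  simp [weightedSextic, pderiv_X, h2, h3, h4, h5, h6]
  ring

theorem aeval_pderiv_one_weightedSextic (p : Fin 4 → Ω) :
    aeval p (pderiv 1 (weightedSextic c b l f u v s)) =
      (algebraMap k Ω (l 1) * p 2 + algebraMap k Ω (f 0) * p 1 ^ 2 +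
        algebraMap k Ω (f 2) * p 0 ^ 2) * p 3 +
      p 0 * (algebraMap k Ω (u 1) * p 2 ^ 2 +
        (algebraMap k Ω (v 1) * p 1 ^ 2 + algebraMap k Ω (v 3) * p 0 ^ 2) * p 2 +
        (algebraMap k Ω (s 1) * p 1 ^ 4 + algebraMap k Ω (s 3) * (p 0 ^ 2 * p 1 ^ 2) +
          algebraMap k Ω (s 5) * p 0 ^ 4)) := by
  have h2 : (2 : Ω) = 0 := CharTwo.two_eq_zero
  have h3 : (3 : Ω) = 1 := by linear_combination h2
  have h4 : (4 : Ω) = 0 := by linear_combination 2 * h2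
  have h5 : (5 : Ω) = 1 := by linear_combination 2 * h2
  have h6 : (6 : Ω) = 0 := by linear_combination 3 * h2
  simp [weightedSextic, pderiv_X, h2, h3, h4, h5, h6]
  ring

theorem aeval_pderiv_two_weightedSextic (p : Fin 4 → Ω) :
    aeval p (pderiv 2 (weightedSextic c b l f u v s)) =
      (algebraMap k Ω (l 0) * p 0 + algebraMap k Ω (l 1) * p 1) * p 3 +
      algebraMap k Ω b * p 2 ^ 2 +
      (algebraMap k Ω (v 0) * p 1 ^ 4 + algebraMap k Ω (v 1) * (p 0 * p 1 ^ 3) +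
        algebraMap k Ω (v 2) * (p 0 ^ 2 * p 1 ^ 2) + algebraMap k Ω (v 3) * (p 0 ^ 3 * p 1) +
        algebraMap k Ω (v 4) * p 0 ^ 4) := by
  have h2 : (2 : Ω) = 0 := CharTwo.two_eq_zero
  have h3 : (3 : Ω) = 1 := by linear_combination h2
  simp [weightedSextic, pderiv_X, h2, h3]
  ring

theorem aeval_pderiv_three_weightedSextic (p : Fin 4 → Ω) :
    aeval p (pderiv 3 (weightedSextic c b l f u v s)) =
      (algebraMap k Ω (l 0) * p 0 + algebraMap k Ω (l 1) * p 1) * p 2 +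
        (algebraMap k Ω (f 0) * p 1 ^ 3 + algebraMap k Ω (f 1) * (p 0 * p 1 ^ 2) +
          algebraMap k Ω (f 2) * (p 0 ^ 2 * p 1) + algebraMap k Ω (f 3) * p 0 ^ 3) := by
  have h2 : (2 : Ω) = 0 := CharTwo.two_eq_zero
  simp [weightedSextic, pderiv_X, h2]

end

theorem not_algebraicIndependent_of_isAlgebraic_adjoin {k Ω : Type*} [Field k] [Field Ω]
    [Algebra k Ω] {n : ℕ} {a : Fin n → Ω} {s : Set Ω} (hs : s.encard < n)
    (ha : ∀ i, IsAlgebraic (Algebra.adjoin k s) (a i)) : ¬ AlgebraicIndependent k a := by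
  intro h
  have hsub : Set.range a ⊆ (AlgebraicIndependent.matroid k Ω).closure s := by
    rw [AlgebraicIndependent.matroid_closure_eq]
    rintro _ ⟨i, rfl⟩
    exact ha i
  have hind : (AlgebraicIndependent.matroid k Ω).Indep (Set.range a) :=
    AlgebraicIndependent.matroid_indep_iff.2 h.coe_range
  have h1 := hind.encard_le_eRk_of_subset hsub
  rw [Matroid.eRk_closure_eq] at h1
  have h2 := h1.trans (Matroid.eRk_le_encard _ _)
  have h3 : (Set.range a).encard = n := by
    rw [← Set.image_univ, h.injective.injOn.encard_image]; simp
  rw [h3] at h2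
  exact absurd h2 (not_le.2 hs)

theorem exists_X_pow_mem_of_zeroLocus_subset {k K σ : Type*} [Field k] [Field K] [Algebra k K]
    [IsAlgClosed K] [Finite σ] {I : Ideal (MvPolynomial σ k)}
    (h : ∀ p : σ → K, (∀ f ∈ I, aeval p f = 0) → p = 0) (i : σ) :
    ∃ N : ℕ, (X i : MvPolynomial σ k) ^ N ∈ I := by
  have : (X i : MvPolynomial σ k) ∈ vanishingIdeal k (zeroLocus K I) := by
    intro p hp
    simp [h p hp]
  rwa [vanishingIdeal_zeroLocus_eq_radical] at this

theorem exists_C_mul_mem_span_of_map {R L σ : Type*} [CommRing R] [IsDomain R] [Field L]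
    [Algebra R L] [IsFractionRing R L] {I : Ideal (MvPolynomial σ R)} {f : MvPolynomial σ R}
    (h : MvPolynomial.map (algebraMap R L) f ∈ I.map (MvPolynomial.map (algebraMap R L))) :
    ∃ g : R, g ≠ 0 ∧ C g * f ∈ I := by
  let := algebraMvPolynomial (R := R) (S := L) (σ := σ)
  have := (IsLocalization.algebraMap_mem_map_algebraMap_iff
    ((nonZeroDivisors R).map (C (σ := σ))) (MvPolynomial σ L) I f).1 h
  obtain ⟨m, ⟨g, hg, rfl⟩, hm⟩ := this
  exact ⟨g, nonZeroDivisors.ne_zero hg, hm⟩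

theorem aeval_mem_intermediateField {k Ω σ : Type*} [Field k] [Field Ω] [Algebra k Ω]
    (E : IntermediateField k Ω) {p : σ → Ω} (hp : ∀ i, p i ∈ E) (G : MvPolynomial σ k) :
    aeval p G ∈ E := by
  induction G using MvPolynomial.induction_on with
  | C r => simp
  | add G H hG hH => rw [map_add]; exact E.add_mem hG hH
  | mul_X G i hG => rw [map_mul, aeval_X]; exact E.mul_mem hG (hp i)

theorem exists_intermediateField_not_algebraicIndependent {k Ω : Type*} [Field k] [Field Ω]
    [Algebra k Ω] (s : Set Ω) :
    ∃ E : IntermediateField k Ω, s ⊆ E ∧ (∀ x, IsAlgebraic k x → x ∈ E) ∧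
      (∀ x, x ^ 2 ∈ E → x ∈ E) ∧
      ∀ (n : ℕ) (a : Fin n → Ω), s.encard < n → (∀ i, a i ∈ E) → ¬ AlgebraicIndependent k a :=
  ⟨((Subalgebra.algebraicClosure (Algebra.adjoin k s) Ω).restrictScalars k).toIntermediateField
      fun _ hx ↦ IsAlgebraic.inv hx,
    fun x hx ↦ isAlgebraic_algebraMap (⟨x, Algebra.subset_adjoin hx⟩ : Algebra.adjoin k s),
    fun _ hx ↦ hx.extendScalars (FaithfulSMul.algebraMap_injective k (Algebra.adjoin k s)),
    fun _ hx ↦ IsAlgebraic.of_pow two_pos hx,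
    fun _ _ hs ha ↦ not_algebraicIndependent_of_isAlgebraic_adjoin hs ha⟩

theorem exists_ne_zero_forall_eq_zero_of_generic {R L Ω σ : Type*} [CommRing R] [IsDomain R]
    [Field L] [Algebra R L] [IsFractionRing R L] [Field Ω] [IsAlgClosed Ω] [Algebra L Ω]
    [Fintype σ] {S : Set (MvPolynomial σ R)}
    (hS : ∀ p : σ → Ω, (∀ f ∈ S, eval₂ ((algebraMap L Ω).comp (algebraMap R L)) p f = 0) → p = 0) :
    ∃ g : R, g ≠ 0 ∧ ∀ (A : Type*) [Field A] (ψ : R →+* A) (p : σ → A),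
      (∀ f ∈ S, eval₂ ψ p f = 0) → ψ g ≠ 0 → p = 0 := by
  have hX := exists_X_pow_mem_of_zeroLocus_subset (K := Ω)
    (I := (Ideal.span S).map (MvPolynomial.map (algebraMap R L))) (fun p hp ↦ hS p fun f hf ↦ by
      have := hp _ (Ideal.mem_map_of_mem _ (Ideal.subset_span hf))
      rwa [aeval_def, eval₂_map] at this)
  choose N hN using hX
  have hg (i : σ) : ∃ g : R, g ≠ 0 ∧ C g * X i ^ N i ∈ Ideal.span S :=
    exists_C_mul_mem_span_of_map (L := L) (by simpa using hN i)
  choose g hg0 hg using hg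
  refine ⟨∏ i, g i, Finset.prod_ne_zero_iff.2 fun i _ ↦ hg0 i, fun A _ ψ p hp hne ↦ ?_⟩
  rw [map_prod, Finset.prod_ne_zero_iff] at hne
  have hker : Ideal.span S ≤ RingHom.ker (eval₂Hom ψ p) := Ideal.span_le.2 hp
  ext i
  have := hker (hg i)
  rw [RingHom.mem_ker, coe_eval₂Hom, eval₂_mul, eval₂_pow, eval₂_C, eval₂_X] at this
  exact eq_zero_of_pow_eq_zero ((mul_eq_zero.1 this).resolve_left (hne i (Finset.mem_univ i)))

/-- The affine cone is smooth away from the origin at its `Ω`-points. -/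
def SmoothConeOver {k : Type*} [Field k] (Ω : Type*) [Field Ω] [Algebra k Ω]
    (F : MvPolynomial (Fin 4) k) : Prop :=
  ∀ p : Fin 4 → Ω, p ≠ 0 → aeval p F = 0 → ∃ i, aeval p (pderiv i F) ≠ 0

theorem SmoothConeOver.of_isAlgClosed {k K Ω : Type*} [Field k] [Field K] [Algebra k K]
    [IsAlgClosed K] [Field Ω] [Algebra k Ω] {F : MvPolynomial (Fin 4) k}
    (h : SmoothConeOver K F) : SmoothConeOver Ω F := by
  intro p hp hF
  by_contra! hd
  refine hp ?_
  have hX := exists_X_pow_mem_of_zeroLocus_subset (K := K)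
    (I := Ideal.span (insert F (Set.range fun i ↦ pderiv i F))) (fun q hq ↦ by
      by_contra hq0
      obtain ⟨i, hi⟩ := h q hq0 (hq _ (Ideal.subset_span (Set.mem_insert _ _)))
      exact hi (hq _ (Ideal.subset_span (Set.mem_insert_of_mem _ ⟨i, rfl⟩))))
  have hker : Ideal.span (insert F (Set.range fun i ↦ pderiv i F)) ≤
      RingHom.ker (aeval (R := k) p) := Ideal.span_le.2 <| by
    rintro _ (rfl | ⟨i, rfl⟩)
    exacts [hF, hd i]
  ext i
  obtain ⟨N, hN⟩ := hX i
  have := hker hN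
  rw [RingHom.mem_ker, map_pow, aeval_X] at this
  exact eq_zero_of_pow_eq_zero this

/-- A binary octic form over an algebraically closed field has a nontrivial zero. -/
theorem exists_root_binary_octic {K : Type*} [Field K] [IsAlgClosed K] (e : Fin 9 → K) :
    ∃ x y : K, (x ≠ 0 ∨ y ≠ 0) ∧ ∑ i : Fin 9, e i * x ^ (i : ℕ) * y ^ (8 - i : ℕ) = 0 := by
  by_cases h8 : e 8 = 0
  · refine ⟨1, 0, by simp, ?_⟩
    simp [Fin.sum_univ_succ, h8]
  · let P : Polynomial K := ∑ i : Fin 9, Polynomial.C (e i) * Polynomial.X ^ (i : ℕ)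
    have hc : P.coeff 8 = e 8 := by
      simp [P, Polynomial.coeff_C_mul, Polynomial.coeff_X_pow,
        Fin.sum_univ_succ]
    have hd : P.degree ≠ 0 := by
      intro h0
      exact h8 (hc ▸ Polynomial.coeff_eq_zero_of_degree_lt (by rw [h0]; norm_num))
    obtain ⟨x, hx⟩ := IsAlgClosed.exists_root P hd
    refine ⟨x, 1, by simp, ?_⟩
    simpa [P, Polynomial.IsRoot, Polynomial.eval_finsetSum] using hx

section
variable {k Ω : Type*} [Field k] [Field Ω] [Algebra k Ω] {c b : k} {l : Fin 2 → k}
    {f : Fin 4 → k} {u : Fin 3 → k} {v : Fin 5 → k} {s : Fin 7 → k} [CharP Ω 2]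

theorem SmoothConeOver.coeff_sq_ne_zero
    (h : SmoothConeOver Ω (weightedSextic c b l f u v s)) : c ≠ 0 := by
  rintro rfl
  obtain ⟨i, hi⟩ := h ![0, 0, 0, 1] (fun h ↦ by simpa using congrFun h 3) (by
    rw [aeval_weightedSextic]; simp)
  fin_cases i
  · exact hi ((aeval_pderiv_zero_weightedSextic ..).trans (by simp))
  · exact hi ((aeval_pderiv_one_weightedSextic ..).trans (by simp))
  · exact hi ((aeval_pderiv_two_weightedSextic ..).trans (by simp))
  · exact hi ((aeval_pderiv_three_weightedSextic ..).trans (by simp))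

theorem SmoothConeOver.coeff_cube_ne_zero
    (h : SmoothConeOver Ω (weightedSextic c b l f u v s)) : b ≠ 0 := by
  rintro rfl
  obtain ⟨i, hi⟩ := h ![0, 0, 1, 0] (fun h ↦ by simpa using congrFun h 2) (by
    rw [aeval_weightedSextic]; simp)
  fin_cases i
  · exact hi ((aeval_pderiv_zero_weightedSextic ..).trans (by simp))
  · exact hi ((aeval_pderiv_one_weightedSextic ..).trans (by simp))
  · exact hi ((aeval_pderiv_two_weightedSextic ..).trans (by simp))
  · exact hi ((aeval_pderiv_three_weightedSextic ..).trans (by simp))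

/-- If the coefficient of the last variable vanishes identically, then the partial derivatives of
the sextic have a common zero; this is the system solved here. -/
theorem exists_common_zero_quadratics {K : Type*} [Field K] [IsAlgClosed K] [CharP K 2]
    (b m : K) (hb : b ≠ 0) (v : Fin 5 → K) (s₁ s₃ s₅ : K) :
    ∃ x y z : K, (x ≠ 0 ∨ y ≠ 0) ∧
      b * z ^ 2 + (v 0 * y ^ 4 + v 1 * (x * y ^ 3) + v 2 * (x ^ 2 * y ^ 2) + v 3 * (x ^ 3 * y) +
        v 4 * x ^ 4) = 0 ∧
      m * z ^ 2 + (v 1 * y ^ 2 + v 3 * x ^ 2) * z +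
        (s₁ * y ^ 4 + s₃ * (x ^ 2 * y ^ 2) + s₅ * x ^ 4) = 0 := by
  obtain ⟨r, hr⟩ : ∃ r : Fin 5 → K, ∀ i, v i = b * r i :=
    ⟨fun i ↦ v i / b, fun i ↦ by field_simp⟩
  obtain ⟨x, y, hxy, h⟩ := exists_root_binary_octic ![
    (m * r 0 + s₁) ^ 2 + v 1 ^ 2 * r 0, v 1 ^ 2 * r 1, (m * r 1) ^ 2 + v 1 ^ 2 * r 2,
    v 1 ^ 2 * r 3, (m * r 2 + s₃) ^ 2 + v 1 ^ 2 * r 4 + v 3 ^ 2 * r 0, v 3 ^ 2 * r 1,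
    (m * r 3) ^ 2 + v 3 ^ 2 * r 2, v 3 ^ 2 * r 3, (m * r 4 + s₅) ^ 2 + v 3 ^ 2 * r 4]
  obtain ⟨z, hz⟩ := IsAlgClosed.exists_pow_nat_eq (r 0 * y ^ 4 + r 1 * (x * y ^ 3) +
    r 2 * (x ^ 2 * y ^ 2) + r 3 * (x ^ 3 * y) + r 4 * x ^ 4) (n := 2) (by norm_num)
  have h2 : (2 : K) = 0 := CharTwo.two_eq_zero
  refine ⟨x, y, z, hxy, ?_, ?_⟩
  · rw [hz]
    simp only [hr]
    linear_combination b * (r 0 * y ^ 4 + r 1 * (x * y ^ 3) +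
      r 2 * (x ^ 2 * y ^ 2) + r 3 * (x ^ 3 * y) + r 4 * x ^ 4) * h2
  · refine pow_eq_zero_iff two_ne_zero |>.1 ?_
    simp [Fin.sum_univ_succ, Fin.succ] at h
    rw [CharTwo.add_sq, CharTwo.add_sq, mul_pow _ z, hz, ← h]
    simp only [CharTwo.add_sq, mul_pow]
    ring

theorem SmoothConeOver.linear_or_cubic_ne_zero [IsAlgClosed Ω]
    (h : SmoothConeOver Ω (weightedSextic c b l f u v s)) : l ≠ 0 ∨ f ≠ 0 := by
  by_contra! hlf
  obtain ⟨rfl, rfl⟩ := hlf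
  have hc : algebraMap k Ω c ≠ 0 := by simpa using SmoothConeOver.coeff_sq_ne_zero h
  have hb : algebraMap k Ω b ≠ 0 := by simpa using SmoothConeOver.coeff_cube_ne_zero h
  obtain ⟨x, y, z, hxy, h₁, h₂⟩ := exists_common_zero_quadratics _ (algebraMap k Ω (u 1)) hb
    (fun i ↦ algebraMap k Ω (v i)) (algebraMap k Ω (s 1)) (algebraMap k Ω (s 3))
    (algebraMap k Ω (s 5))
  obtain ⟨w, hw⟩ := IsAlgClosed.exists_pow_nat_eq
    (-aeval ![x, y, z, 0] (weightedSextic c b 0 0 u v s) / algebraMap k Ω c) (n := 2)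
    (by norm_num)
  have hw' : algebraMap k Ω c * w ^ 2 = -aeval ![x, y, z, 0] (weightedSextic c b 0 0 u v s) := by
    rw [hw]; field_simp
  obtain ⟨i, hi⟩ := h ![x, y, z, w] (fun h ↦ by
      have h0 := congrFun h 0
      have h1 := congrFun h 1
      simp_all) (by
    rw [aeval_weightedSextic] at hw' ⊢
    simp at hw' ⊢
    rw [hw']
    ring)
  fin_cases i
  · exact hi ((aeval_pderiv_zero_weightedSextic ..).trans (by simp [h₂]))
  · exact hi ((aeval_pderiv_one_weightedSextic ..).trans (by simp [h₂]))
  · exact hi ((aeval_pderiv_two_weightedSextic ..).trans (by simpa using h₁))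
  · exact hi ((aeval_pderiv_three_weightedSextic ..).trans (by simp))

end

theorem isAlgebraic_of_linear_of_cubic {k Ω : Type*} [Field k] [Field Ω] [Algebra k Ω]
    {l : Fin 2 → k} {f : Fin 4 → k} (hlf : l ≠ 0 ∨ f ≠ 0) {x : Ω}
    (hl : algebraMap k Ω (l 0) * x + algebraMap k Ω (l 1) = 0)
    (hf : algebraMap k Ω (f 0) + algebraMap k Ω (f 1) * x + algebraMap k Ω (f 2) * x ^ 2 +
      algebraMap k Ω (f 3) * x ^ 3 = 0) : IsAlgebraic k x := by
  rcases hlf with h | h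
  · refine ⟨Cubic.toPoly ⟨0, 0, l 0, l 1⟩, fun h0 ↦ h ?_, by simpa [Cubic.toPoly] using hl⟩
    have := (Cubic.toPoly_injective _ (0 : Cubic k)).1 (h0.trans Cubic.zero.symm)
    simp only [Cubic.ext_iff] at this
    ext j
    fin_cases j
    exacts [this.2.2.1, this.2.2.2]
  · refine ⟨Cubic.toPoly ⟨f 3, f 2, f 1, f 0⟩, fun h0 ↦ h ?_, ?_⟩
    · have := (Cubic.toPoly_injective _ (0 : Cubic k)).1 (h0.trans Cubic.zero.symm)
      simp only [Cubic.ext_iff] at this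
      ext j
      fin_cases j
      exacts [this.2.2.2, this.2.2.1, this.2.1, this.1]
    · simp [Cubic.toPoly]
      linear_combination hf

/-- In characteristic `2` and for `a 3 ≠ 0`, the conditions for the hyperplane section with
coefficients `a` of the surface `F = 0` to contain the point `p` of the cone and to be singular
there. -/
structure IsSingularSectionPoint {k Ω : Type*} [Field k] [Field Ω] [Algebra k Ω]
    (F : MvPolynomial (Fin 4) k) (a p : Fin 4 → Ω) : Prop where
  sextic : aeval p F = 0
  hyperplane : a 0 * p 0 ^ 2 + a 1 * (p 0 * p 1) + a 2 * p 1 ^ 2 + a 3 * p 2 = 0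
  pderiv_three : aeval p (pderiv 3 F) = 0
  pderiv_zero : a 1 * p 1 * aeval p (pderiv 2 F) = a 3 * aeval p (pderiv 0 F)
  pderiv_one : a 1 * p 0 * aeval p (pderiv 2 F) = a 3 * aeval p (pderiv 1 F)

section
variable {k Ω : Type*} [Field k] [Field Ω] [Algebra k Ω] {c b : k} {l : Fin 2 → k}
    {f : Fin 4 → k} {u : Fin 3 → k} {v : Fin 5 → k} {s : Fin 7 → k} [CharP Ω 2]
    {a p : Fin 4 → Ω}

theorem IsSingularSectionPoint.scale
    (h : IsSingularSectionPoint (weightedSextic c b l f u v s) a p) (t : Ω) :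
    IsSingularSectionPoint (weightedSextic c b l f u v s) a
      ![t * p 0, t * p 1, t ^ 2 * p 2, t ^ 3 * p 3] := by
  obtain ⟨h₁, h₂, h₃, h₄, h₅⟩ := h
  rw [aeval_weightedSextic] at h₁
  rw [aeval_pderiv_three_weightedSextic] at h₃
  rw [aeval_pderiv_two_weightedSextic, aeval_pderiv_zero_weightedSextic] at h₄
  rw [aeval_pderiv_two_weightedSextic, aeval_pderiv_one_weightedSextic] at h₅
  constructor
  · rw [aeval_weightedSextic]
    simp
    linear_combination t ^ 6 * h₁
  · simp
    linear_combination t ^ 2 * h₂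
  · rw [aeval_pderiv_three_weightedSextic]
    simp
    linear_combination t ^ 3 * h₃
  · rw [aeval_pderiv_two_weightedSextic, aeval_pderiv_zero_weightedSextic]
    simp
    linear_combination t ^ 5 * h₄
  · rw [aeval_pderiv_two_weightedSextic, aeval_pderiv_one_weightedSextic]
    simp
    linear_combination t ^ 5 * h₅

theorem IsSingularSectionPoint.mem_intermediateField
    (h : IsSingularSectionPoint (weightedSextic c b l f u v s) a p)
    (hF : SmoothConeOver Ω (weightedSextic c b l f u v s)) (h3 : a 3 ≠ 0) (hp : p ≠ 0)
    {E : IntermediateField k Ω} (hE : ∀ x, x ^ 2 ∈ E → x ∈ E) (p0 : p 0 ∈ E) (p1 : p 1 ∈ E)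
    (p2 : p 2 ∈ E) (a3 : a 3 ∈ E) (ha : (p 1 ≠ 0 ∧ a 0 ∈ E) ∨ (p 0 ≠ 0 ∧ a 2 ∈ E)) (i : Fin 4) :
    a i ∈ E := by
  have hc : algebraMap k Ω c ≠ 0 := by simpa using SmoothConeOver.coeff_sq_ne_zero hF
  have p3 : p 3 ∈ E := by
    apply hE
    have hw : p 3 ^ 2 = - aeval ![p 0, p 1, p 2, 0] (weightedSextic c b l f u v s) /
        algebraMap k Ω c := by
      have h₁ := h.sextic
      have h₃ := h.pderiv_three
      rw [aeval_weightedSextic] at h₁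
      rw [aeval_pderiv_three_weightedSextic] at h₃
      rw [aeval_weightedSextic, eq_div_iff hc]
      simp
      linear_combination h₁ - p 3 * h₃
    rw [hw]
    refine E.div_mem (E.neg_mem (aeval_mem_intermediateField E ?_ _)) (E.algebraMap_mem c)
    intro j
    fin_cases j
    exacts [p0, p1, p2, E.zero_mem]
  have hG (G : MvPolynomial (Fin 4) k) : aeval p G ∈ E := by
    refine aeval_mem_intermediateField E ?_ _
    intro j
    fin_cases j
    exacts [p0, p1, p2, p3]
  have hz : aeval p (pderiv 2 (weightedSextic c b l f u v s)) ≠ 0 := by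
    intro hz
    obtain ⟨j, hj⟩ := hF p hp h.sextic
    have h₄ := h.pderiv_zero
    have h₅ := h.pderiv_one
    rw [hz, mul_zero, zero_eq_mul] at h₄ h₅
    fin_cases j
    exacts [hj (h₄.resolve_left h3), hj (h₅.resolve_left h3), hj hz, hj h.pderiv_three]
  have hh := h.hyperplane
  rcases ha with ⟨h1, a0⟩ | ⟨h0, a2⟩
  · have a1 : a 1 ∈ E := by
      have : a 1 = a 3 * aeval p (pderiv 0 (weightedSextic c b l f u v s)) /
          (p 1 * aeval p (pderiv 2 (weightedSextic c b l f u v s))) := by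
        rw [eq_div_iff (mul_ne_zero h1 hz), ← h.pderiv_zero]
        ring
      rw [this]
      exact E.div_mem (E.mul_mem a3 (hG _)) (E.mul_mem p1 (hG _))
    have a2 : a 2 ∈ E := by
      have : a 2 = -(a 0 * p 0 ^ 2 + a 1 * (p 0 * p 1) + a 3 * p 2) / p 1 ^ 2 := by
        rw [eq_div_iff (pow_ne_zero 2 h1)]
        linear_combination hh
      rw [this]
      exact E.div_mem (E.neg_mem (E.add_mem (E.add_mem (E.mul_mem a0 (pow_mem p0 2))
        (E.mul_mem a1 (E.mul_mem p0 p1))) (E.mul_mem a3 p2))) (pow_mem p1 2)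
    fin_cases i
    exacts [a0, a1, a2, a3]
  · have a1 : a 1 ∈ E := by
      have : a 1 = a 3 * aeval p (pderiv 1 (weightedSextic c b l f u v s)) /
          (p 0 * aeval p (pderiv 2 (weightedSextic c b l f u v s))) := by
        rw [eq_div_iff (mul_ne_zero h0 hz), ← h.pderiv_one]
        ring
      rw [this]
      exact E.div_mem (E.mul_mem a3 (hG _)) (E.mul_mem p0 (hG _))
    have a0 : a 0 ∈ E := by
      have : a 0 = -(a 2 * p 1 ^ 2 + a 1 * (p 0 * p 1) + a 3 * p 2) / p 0 ^ 2 := by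
        rw [eq_div_iff (pow_ne_zero 2 h0)]
        linear_combination hh
      rw [this]
      exact E.div_mem (E.neg_mem (E.add_mem (E.add_mem (E.mul_mem a2 (pow_mem p1 2))
        (E.mul_mem a1 (E.mul_mem p0 p1))) (E.mul_mem a3 p2))) (pow_mem p0 2)
    fin_cases i
    exacts [a0, a1, a2, a3]

/-- The coordinates of a singular point lie in a field of transcendence degree at most `3`
containing the coefficients of the hyperplane. -/
theorem not_isSingularSectionPoint_of_algebraicIndependent
    (hF : SmoothConeOver Ω (weightedSextic c b l f u v s)) (hlf : l ≠ 0 ∨ f ≠ 0)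
    (ha : AlgebraicIndependent k a) (hp : p ≠ 0) :
    ¬ IsSingularSectionPoint (weightedSextic c b l f u v s) a p := by
  intro h
  have h3 : a 3 ≠ 0 := ha.ne_zero 3
  have henc (x y z : Ω) : ({x, y, z} : Set Ω).encard < (4 : ℕ) :=
    lt_of_le_of_lt ((Set.encard_insert_le _ _).trans
      (add_le_add_left (Set.encard_insert_le _ _) 1)) (by rw [Set.encard_singleton]; norm_num)
  by_cases h1 : p 1 = 0
  · by_cases h0 : p 0 = 0
    · have h2 : p 2 = 0 := by simpa [h0, h1, h3] using h.hyperplane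
      have hc : algebraMap k Ω c ≠ 0 := by simpa using SmoothConeOver.coeff_sq_ne_zero hF
      have h4 := h.sextic
      rw [aeval_weightedSextic] at h4
      simp [h0, h1, h2, hc] at h4
      refine hp (funext fun i ↦ ?_)
      fin_cases i <;> simp_all
    · have h' := h.scale (p 0)⁻¹
      rw [inv_mul_cancel₀ h0, h1, mul_zero] at h'
      obtain ⟨E, hs, -, hsq, hE⟩ := exists_intermediateField_not_algebraicIndependent (k := k)
        ({(p 0)⁻¹ ^ 2 * p 2, a 2, a 3} : Set Ω)
      refine hE 4 a (henc _ _ _) (h'.mem_intermediateField hF h3 (fun h ↦ by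
        simpa using congrFun h 0) hsq E.one_mem E.zero_mem (hs (by simp)) (hs (by simp))
        (.inr ⟨one_ne_zero, hs (by simp)⟩)) ha
  · have h' := h.scale (p 1)⁻¹
    rw [inv_mul_cancel₀ h1] at h'
    generalize (p 1)⁻¹ * p 0 = x at h'
    generalize (p 1)⁻¹ ^ 2 * p 2 = z at h'
    obtain ⟨t, ht⟩ : ∃ t, ∀ E : IntermediateField k Ω, t ∈ E → (∀ x, IsAlgebraic k x → x ∈ E) →
        x ∈ E ∧ z ∈ E := by
      by_cases hx : IsAlgebraic k x
      · exact ⟨z, fun E hz hE ↦ ⟨hE x hx, hz⟩⟩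
      · refine ⟨x, fun E hxE _ ↦ ⟨hxE, ?_⟩⟩
        have h₃ := h'.pderiv_three
        rw [aeval_pderiv_three_weightedSextic] at h₃
        simp at h₃
        have hl : algebraMap k Ω (l 0) * x + algebraMap k Ω (l 1) ≠ 0 := fun hl ↦
          hx (isAlgebraic_of_linear_of_cubic hlf hl (by linear_combination h₃ - z * hl))
        have hz : z = -Polynomial.aeval x (Cubic.toPoly ⟨f 3, f 2, f 1, f 0⟩) /
            Polynomial.aeval x (Cubic.toPoly ⟨0, 0, l 0, l 1⟩) := by
          simp only [Cubic.toPoly]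
          simp
          rw [eq_div_iff hl]
          linear_combination h₃
        have hmem (P : Polynomial k) : Polynomial.aeval x P ∈ E :=
          Algebra.adjoin_le (S := E.toSubalgebra) (Set.singleton_subset_iff.2 hxE)
            (Polynomial.aeval_mem_adjoin_singleton k x)
        rw [hz]
        exact E.div_mem (E.neg_mem (hmem _)) (hmem _)
    obtain ⟨E, hs, halg, hsq, hE⟩ := exists_intermediateField_not_algebraicIndependent (k := k)
      ({t, a 0, a 3} : Set Ω)
    obtain ⟨hx, hz⟩ := ht E (hs (by simp)) halg
    exact hE 4 a (henc _ _ _) (h'.mem_intermediateField hF h3 (fun h ↦ by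
        simpa using congrFun h 1) hsq hx E.one_mem hz (hs (by simp))
        (.inl ⟨one_ne_zero, hs (by simp)⟩)) ha

end

theorem eval_smul_of_isHomogeneous {R σ : Type*} [CommSemiring R] {G : MvPolynomial σ R} {n : ℕ}
    (hG : G.IsHomogeneous n) (t : R) (a : σ → R) : eval (t • a) G = t ^ n * eval a G := by
  rw [eval_eq, eval_eq, Finset.mul_sum]
  refine Finset.sum_congr rfl fun d hd ↦ ?_
  have := hG (mem_support_iff.1 hd)
  rw [Finsupp.weight_apply, Finsupp.sum] at this
  simp only [Pi.one_apply, smul_eq_mul, mul_one] at this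
  simp only [Pi.smul_apply, smul_eq_mul, mul_pow, Finset.prod_mul_distrib]
  rw [Finset.prod_pow_eq_pow_sum, this]
  ring

theorem exists_eval_smul_ne_zero {K σ : Type*} [Field K] [Infinite K] (G : MvPolynomial σ K)
    (n : ℕ) {a : σ → K} (ha : eval a (homogeneousComponent n G) ≠ 0) :
    ∃ t : K, eval (t • a) G ≠ 0 := by
  let P : Polynomial K := ∑ i ∈ Finset.range (G.totalDegree + 1),
    Polynomial.C (eval a (homogeneousComponent i G)) * Polynomial.X ^ i
  have hn : n ∈ Finset.range (G.totalDegree + 1) := by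
    by_contra h
    rw [homogeneousComponent_eq_zero] at ha
    · simp at ha
    · simp at h; omega
  have hP : P ≠ 0 := by
    intro h0
    have : P.coeff n = eval a (homogeneousComponent n G) := by
      simp only [P, Polynomial.finsetSum_coeff, Polynomial.coeff_C_mul_X_pow]
      rw [Finset.sum_ite_eq, if_pos hn]
    rw [h0, Polynomial.coeff_zero] at this
    exact ha this.symm
  have hev (t : K) : P.eval t = eval (t • a) G := by
    conv_rhs => rw [← sum_homogeneousComponent G, map_sum]
    simp only [P, Polynomial.eval_finsetSum]
    refine Finset.sum_congr rfl fun i _ ↦ ?_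
    rw [eval_smul_of_isHomogeneous (homogeneousComponent_isHomogeneous i G), Polynomial.eval_mul,
      Polynomial.eval_C, Polynomial.eval_pow, Polynomial.eval_X, mul_comm]
  by_contra! h
  exact hP (Polynomial.funext fun t ↦ by rw [hev, h t, Polynomial.eval_zero])

theorem SmoothHyperplaneSection.of_smul {k : Type u} [Field k] {F : MvPolynomial (Fin 4) k}
    {a : Fin 4 → AlgebraicClosure k} {t : AlgebraicClosure k}
    (h : SmoothHyperplaneSection F (t • a)) : SmoothHyperplaneSection F a := by
  have hs : hyperplanePullback (t • a) = C t * hyperplanePullback a := by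
    simp [hyperplanePullback]
    ring
  intro p hp hF hH
  obtain ⟨i, j, hij⟩ := h p hp hF (by rw [hs, map_mul, hH, mul_zero])
  refine ⟨i, j, fun h0 ↦ hij ?_⟩
  simp only [hs, pderiv_C_mul, map_sub, map_mul, eval_C] at h0 ⊢
  linear_combination t * h0

/-- The form `hyperplanePullback`, with coefficients in an arbitrary commutative ring. -/
noncomputable def hyperplaneForm {A : Type*} [CommRing A] (a : Fin 4 → A) :
    MvPolynomial (Fin 4) A :=
  C (a 0) * X 0 ^ 2 + C (a 1) * (X 0 * X 1) + C (a 2) * X 1 ^ 2 + C (a 3) * X 2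

theorem map_hyperplaneForm {A B : Type*} [CommRing A] [CommRing B] (ψ : A →+* B) (a : Fin 4 → A) :
    MvPolynomial.map ψ (hyperplaneForm a) = hyperplaneForm (ψ ∘ a) := by
  simp [hyperplaneForm]

/-- The equations of the singular locus of the curve `F = H = 0`: the two equations together with
the `2 × 2` minors of their Jacobian matrix. -/
def hyperplaneSectionEquations {A : Type*} [CommRing A] (F H : MvPolynomial (Fin 4) A) :
    Set (MvPolynomial (Fin 4) A) :=
  {F, H} ∪ Set.range fun ij : Fin 4 × Fin 4 ↦
    pderiv ij.1 F * pderiv ij.2 H - pderiv ij.2 F * pderiv ij.1 H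

theorem forall_mem_hyperplaneSectionEquations {A B : Type*} [CommRing A] [CommRing B]
    (ψ : A →+* B) (p : Fin 4 → B) (F H : MvPolynomial (Fin 4) A) :
    (∀ g ∈ hyperplaneSectionEquations F H, eval₂ ψ p g = 0) ↔
      ∀ g ∈ hyperplaneSectionEquations (MvPolynomial.map ψ F) (MvPolynomial.map ψ H),
        eval p g = 0 := by
  have : hyperplaneSectionEquations (MvPolynomial.map ψ F) (MvPolynomial.map ψ H) =
      MvPolynomial.map ψ '' hyperplaneSectionEquations F H := by
    simp only [hyperplaneSectionEquations, Set.image_union, Set.image_pair, ← Set.range_comp,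
      Function.comp_def, map_sub, map_mul, pderiv_map]
  simp only [this, Set.forall_mem_image, eval₂_eq_eval_map]

theorem eval_map_algebraMap_eq_aeval {k Ω σ : Type*} [CommSemiring k] [CommSemiring Ω]
    [Algebra k Ω] (p : σ → Ω) (F : MvPolynomial σ k) :
    eval p (MvPolynomial.map (algebraMap k Ω) F) = aeval p F := by
  rw [aeval_def, eval_map]

theorem isSingularSectionPoint_of_forall_mem {k Ω : Type*} [Field k] [Field Ω] [Algebra k Ω]
    [CharP Ω 2] {F : MvPolynomial (Fin 4) k} {a p : Fin 4 → Ω} (h3 : a 3 ≠ 0)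
    (h : ∀ g ∈ hyperplaneSectionEquations (MvPolynomial.map (algebraMap k Ω) F)
      (hyperplaneForm a), eval p g = 0) : IsSingularSectionPoint F a p := by
  have h2 : (2 : Ω) = 0 := CharTwo.two_eq_zero
  have hF := h _ (.inl (.inl rfl))
  have hH := h _ (.inl (.inr rfl))
  have hm (i j : Fin 4) := h _ (.inr ⟨(i, j), rfl⟩)
  simp only [pderiv_map, map_sub, map_mul, eval_map_algebraMap_eq_aeval] at hF hm
  have e0 : eval p (pderiv 0 (hyperplaneForm a)) = a 1 * p 1 := by
    simp [hyperplaneForm, pderiv_X, h2]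
  have e1 : eval p (pderiv 1 (hyperplaneForm a)) = a 1 * p 0 := by
    simp [hyperplaneForm, pderiv_X, h2]
  have e2 : eval p (pderiv 2 (hyperplaneForm a)) = a 3 := by
    simp [hyperplaneForm, pderiv_X]
  have e3 : eval p (pderiv 3 (hyperplaneForm a)) = 0 := by
    simp [hyperplaneForm, pderiv_X]
  have m0 := hm 2 0
  have m1 := hm 2 1
  have m3 := hm 3 2
  simp [e0, e1, e2, e3] at m0 m1 m3
  constructor
  · exact hF
  · simpa [hyperplaneForm] using hH
  · exact m3.resolve_right h3
  · linear_combination m0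
  · linear_combination m1

theorem exists_form_smoothHyperplaneSection {k : Type u} [Field k] [CharP k 2]
    {F : MvPolynomial (Fin 4) k} (hF : SmoothSexticDelPezzo F) :
    ∃ G : MvPolynomial (Fin 4) k, G ≠ 0 ∧ ∀ a : Fin 4 → AlgebraicClosure k,
      eval a (MvPolynomial.map (algebraMap k (AlgebraicClosure k)) G) ≠ 0 →
        SmoothHyperplaneSection F a := by
  obtain ⟨hw, hs⟩ := hF
  have hsm : SmoothConeOver (AlgebraicClosure k) F := by
    intro p hp hp0
    simpa only [eval_map_algebraMap_eq_aeval] using hs p hp (by rwa [eval_map_algebraMap_eq_aeval])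
  have : CharP (AlgebraicClosure k) 2 := charP_of_injective_algebraMap' k 2
  let L := FractionRing (MvPolynomial (Fin 4) k)
  let Ω := AlgebraicClosure L
  have : CharP Ω 2 := charP_of_injective_algebraMap' k 2
  let θ : MvPolynomial (Fin 4) k →+* Ω := (algebraMap L Ω).comp (algebraMap _ L)
  have hθ : Function.Injective θ := (algebraMap L Ω).injective.comp (IsFractionRing.injective _ _)
  have hθC : θ.comp C = algebraMap k Ω := by
    rw [IsScalarTower.algebraMap_eq k L Ω, IsScalarTower.algebraMap_eq k (MvPolynomial (Fin 4) k) L,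
      ← RingHom.comp_assoc]
    rfl
  have hind : AlgebraicIndependent k fun i ↦ θ (X i) := by
    have : ⇑(aeval fun i ↦ θ (X i) : MvPolynomial (Fin 4) k →ₐ[k] Ω) = θ := by
      rw [← AlgHom.coe_toRingHom]
      congr 1
      refine MvPolynomial.ringHom_ext (fun r ↦ ?_) fun i ↦ by simp
      simpa using (RingHom.congr_fun hθC r).symm
    rwa [algebraicIndependent_iff_injective_aeval, this]
  obtain ⟨G, hG, h⟩ := exists_ne_zero_forall_eq_zero_of_generic (L := L) (Ω := Ω)
    (S := hyperplaneSectionEquations (MvPolynomial.map C F)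
      (hyperplaneForm (X : Fin 4 → MvPolynomial (Fin 4) k))) (by
    intro p hp
    by_contra hp0
    change ∀ f ∈ _, eval₂ θ p f = 0 at hp
    rw [forall_mem_hyperplaneSectionEquations, map_map, hθC, map_hyperplaneForm] at hp
    have hsing := isSingularSectionPoint_of_forall_mem (hind.ne_zero 3) hp
    have hsmΩ : SmoothConeOver Ω F := hsm.of_isAlgClosed
    obtain ⟨c, b, l, f, u, v, s, rfl⟩ := exists_eq_weightedSextic hw
    exact not_isSingularSectionPoint_of_algebraicIndependent hsmΩ
      (SmoothConeOver.linear_or_cubic_ne_zero hsm) hind hp0 hsing)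
  refine ⟨G, hG, fun a ha p hp hF hH ↦ ?_⟩
  by_contra! hm
  refine hp (h _ (eval₂Hom (algebraMap k (AlgebraicClosure k)) a) p ?_ ?_)
  · rw [forall_mem_hyperplaneSectionEquations, map_map, map_hyperplaneForm]
    have e1 : (eval₂Hom (algebraMap k (AlgebraicClosure k)) a).comp C =
      algebraMap k (AlgebraicClosure k) := eval₂Hom_comp_C _ _
    have e2 : ⇑(eval₂Hom (algebraMap k (AlgebraicClosure k)) a) ∘ X = a := by
      ext i; simp
    rw [e1, e2]
    rintro g ((rfl | rfl) | ⟨⟨i, j⟩, rfl⟩)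
    exacts [hF, hH, hm i j]
  · rwa [coe_eval₂Hom, eval₂_eq_eval_map]

/-- Let `k` be a field of characteristic `2` and `S` a smooth del
Pezzo surface of degree `1` over `k`, with `φ : S → Q ⊂ ℙ³` the degree `2` morphism
given by `|-2K_S|`.  Then there is a dense open subset `U` of the dual projective space
`(ℙ³)∨` — the complement of the vanishing locus of a nonzero homogeneous form `G` of
positive degree in the hyperplane coefficients — such that for every hyperplane
`H ∈ U`, the fiber `S_H = φ⁻¹(H ∩ Q)` is smooth. -/
theorem generic_hyperplane_section_smooth_char_two
    {k : Type u} [Field k] [CharP k 2]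
    (F : MvPolynomial (Fin 4) k) (hF : SmoothSexticDelPezzo F) :
    ∃ (d : ℕ) (G : MvPolynomial (Fin 4) k), 0 < d ∧ G.IsHomogeneous d ∧ G ≠ 0 ∧
      ∀ a : Fin 4 → AlgebraicClosure k,
        MvPolynomial.eval a
          (MvPolynomial.map (algebraMap k (AlgebraicClosure k)) G) ≠ 0 →
        SmoothHyperplaneSection F a := by
  obtain ⟨G, hG, h⟩ := exists_form_smoothHyperplaneSection hF
  obtain ⟨n, hn⟩ : ∃ n, homogeneousComponent n G ≠ 0 := by
    by_contra! h0
    exact hG (by rw [← sum_homogeneousComponent G]; simp [h0])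
  refine ⟨n + 1, homogeneousComponent n G * X 0, n.succ_pos,
    (homogeneousComponent_isHomogeneous n G).mul (isHomogeneous_X k 0),
    mul_ne_zero hn (X_ne_zero 0), fun a ha ↦ ?_⟩
  rw [map_mul, map_mul] at ha
  have : MvPolynomial.map (algebraMap k (AlgebraicClosure k)) (homogeneousComponent n G) =
      homogeneousComponent n (MvPolynomial.map (algebraMap k (AlgebraicClosure k)) G) := by
    ext d
    simp only [coeff_homogeneousComponent, coeff_map]
    split_ifs <;> simp
  rw [this] at ha
  obtain ⟨t, hne⟩ := exists_eval_smul_ne_zero _ n (left_ne_zero_of_mul ha)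
  exact (h _ hne).of_smul
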